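/- Partial reduction yields a symplectic cross-section for the rotation symmetry: let V = (ℝ³×ℝ³)ⁿ with the standard symplectic bilinear form Ω, and let C⃗ : V → ℝ³, C⃗(P,Q) = Σᵢ Qᵢ × Pᵢ, with components C_x, C_y, C_z. If z ∈ V is a point with C_x(z) = C_y(z) = 0 and C_z(z) = c ≠ 0, then the restriction of Ω to the subspace ker(DC_x(z)) ∩ ker(DC_y(z)) of V (the tangent space at z of the submanifold obtained by fixing the direction of the angular momentum to the vertical direction) is nondegenerate. -/

import Mathlib

open scoped BigOperators

/-- The total angular momentum `C⃗(P,Q) = Σᵢ Qᵢ × Pᵢ` on the phase space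
`(ℝ³ × ℝ³)ⁿ`, where `z.1 = P` are the momenta and `z.2 = Q` the positions. -/
def totalAngMom {n : ℕ} (z : (Fin n → (Fin 3 → ℝ)) × (Fin n → (Fin 3 → ℝ))) :
    Fin 3 → ℝ :=
  ∑ i : Fin n, crossProduct (z.2 i) (z.1 i)

/-- The standard symplectic bilinear form
`Ω((P,Q),(P',Q')) = Σᵢ (⟨Pᵢ, Q'ᵢ⟩ − ⟨P'ᵢ, Qᵢ⟩)` on `(ℝ³ × ℝ³)ⁿ`. -/
def stdSymp {n : ℕ}
    (u v : (Fin n → (Fin 3 → ℝ)) × (Fin n → (Fin 3 → ℝ))) : ℝ :=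
  ∑ i : Fin n, ((∑ l : Fin 3, u.1 i l * v.2 i l) - (∑ l : Fin 3, v.1 i l * u.2 i l))

/-- The derivative of `totalAngMom` at `z` in the direction `v`. -/
def angMomDeriv {n : ℕ} (z v : (Fin n → (Fin 3 → ℝ)) × (Fin n → (Fin 3 → ℝ))) : Fin 3 → ℝ :=
  ∑ i : Fin n, (crossProduct (v.2 i) (z.1 i) + crossProduct (z.2 i) (v.1 i))

/-- The infinitesimal rotation about the axis `a`, evaluated at `z`. -/
def infinitesimalRotation {n : ℕ} (a : Fin 3 → ℝ)
    (z : (Fin n → (Fin 3 → ℝ)) × (Fin n → (Fin 3 → ℝ))) :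
    (Fin n → (Fin 3 → ℝ)) × (Fin n → (Fin 3 → ℝ)) :=
  (fun i => crossProduct a (z.1 i), fun i => crossProduct a (z.2 i))

section

variable {n : ℕ} (z u v w : (Fin n → (Fin 3 → ℝ)) × (Fin n → (Fin 3 → ℝ)))

theorem totalAngMom_add : totalAngMom (z + v) = totalAngMom z + angMomDeriv z v + totalAngMom v := by
  simp only [totalAngMom, angMomDeriv, ← Finset.sum_add_distrib]
  refine Finset.sum_congr rfl fun i _ => ?_
  simp only [Prod.fst_add, Prod.snd_add, Pi.add_apply, map_add, LinearMap.add_apply]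
  abel

theorem totalAngMom_smul (t : ℝ) : totalAngMom (t • v) = t ^ 2 • totalAngMom v := by
  simp [totalAngMom, Finset.smul_sum, smul_smul, pow_two]

theorem angMomDeriv_add : angMomDeriv z (v + w) = angMomDeriv z v + angMomDeriv z w := by
  simp only [angMomDeriv, ← Finset.sum_add_distrib]
  refine Finset.sum_congr rfl fun i _ => ?_
  simp only [Prod.fst_add, Prod.snd_add, Pi.add_apply, map_add, LinearMap.add_apply]
  abel

theorem angMomDeriv_smul (t : ℝ) : angMomDeriv z (t • v) = t • angMomDeriv z v := by
  simp [angMomDeriv, Finset.smul_sum]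

theorem differentiable_totalAngMom (k : Fin 3) :
    Differentiable ℝ
      fun z : (Fin n → (Fin 3 → ℝ)) × (Fin n → (Fin 3 → ℝ)) => totalAngMom z k := by
  fin_cases k <;> simp only [totalAngMom, cross_apply, Finset.sum_apply] <;> simp <;> fun_prop

theorem fderiv_totalAngMom (k : Fin 3) :
    fderiv ℝ (fun z => totalAngMom z k) z v = angMomDeriv z v k := by
  rw [← (differentiable_totalAngMom k z).lineDeriv_eq_fderiv]
  have h : HasDerivAt
      (fun t : ℝ => totalAngMom z k + t * angMomDeriv z v k + t ^ 2 * totalAngMom v k)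
      (angMomDeriv z v k) 0 := by
    simpa using (((hasDerivAt_id (0 : ℝ)).mul_const (angMomDeriv z v k)).const_add
      (totalAngMom z k)).fun_add ((hasDerivAt_pow 2 (0 : ℝ)).mul_const (totalAngMom v k))
  rw [lineDeriv, ← h.deriv]
  congr 1
  funext t
  simp [totalAngMom_add, totalAngMom_smul, angMomDeriv_smul]

theorem angMomDeriv_infinitesimalRotation (a : Fin 3 → ℝ) :
    angMomDeriv z (infinitesimalRotation a z) = crossProduct a (totalAngMom z) := by
  simp only [angMomDeriv, totalAngMom, map_sum]
  refine Finset.sum_congr rfl fun i _ => ?_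
  exact (leibniz_cross a (z.2 i) (z.1 i)).symm

theorem stdSymp_infinitesimalRotation (a : Fin 3 → ℝ) :
    stdSymp v (infinitesimalRotation a z) = a ⬝ᵥ angMomDeriv z v := by
  simp only [stdSymp, infinitesimalRotation, angMomDeriv, dotProduct_sum]
  refine Finset.sum_congr rfl fun i _ => ?_
  simp only [cross_apply, dotProduct, Fin.sum_univ_three, Pi.add_apply, Matrix.cons_val]
  ring

theorem stdSymp_add_right : stdSymp u (v + w) = stdSymp u v + stdSymp u w := by
  simp only [stdSymp, ← Finset.sum_add_distrib]
  refine Finset.sum_congr rfl fun i _ => ?_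
  simp only [Fin.sum_univ_three, Prod.fst_add, Prod.snd_add, Pi.add_apply]
  ring

variable {v}

theorem stdSymp_complexStructure_ne_zero (hv : v ≠ 0) : stdSymp v (-v.2, v.1) ≠ 0 := by
  have key : stdSymp v (-v.2, v.1) = ∑ i, (v.1 i ⬝ᵥ v.1 i + v.2 i ⬝ᵥ v.2 i) := by
    simp [stdSymp, dotProduct]
  have nonneg (x : Fin 3 → ℝ) : 0 ≤ x ⬝ᵥ x := Finset.sum_nonneg fun _ _ => mul_self_nonneg _
  contrapose! hv
  rw [key, Finset.sum_eq_zero_iff_of_nonneg fun i _ => add_nonneg (nonneg _) (nonneg _)] at hv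
  have h (i) := (add_eq_zero_iff_of_nonneg (nonneg _) (nonneg _)).1 (hv i (Finset.mem_univ i))
  exact Prod.ext (funext fun i => dotProduct_self_eq_zero.1 (h i).1)
    (funext fun i => dotProduct_self_eq_zero.1 (h i).2)

end

/-- Partial reduction yields a symplectic cross-section for the rotation
symmetry: at a point `z` where `C_x(z) = C_y(z) = 0` and `C_z(z) = c ≠ 0`, the
restriction of the standard symplectic form to
`ker(DC_x(z)) ∩ ker(DC_y(z))` — the tangent space of the submanifold obtained
by fixing the direction of the angular momentum to the vertical — is
nondegenerate. -/
theorem partial_reduction_cross_section_symplectic {n : ℕ}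
    (Cx Cy Cz : (Fin n → (Fin 3 → ℝ)) × (Fin n → (Fin 3 → ℝ)) → ℝ)
    (hCx : ∀ z, Cx z = totalAngMom z 0)
    (hCy : ∀ z, Cy z = totalAngMom z 1)
    (hCz : ∀ z, Cz z = totalAngMom z 2)
    (z : (Fin n → (Fin 3 → ℝ)) × (Fin n → (Fin 3 → ℝ)))
    (c : ℝ) (hc : c ≠ 0)
    (hzx : Cx z = 0) (hzy : Cy z = 0) (hzz : Cz z = c) :
    ∀ v : (Fin n → (Fin 3 → ℝ)) × (Fin n → (Fin 3 → ℝ)),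
      fderiv ℝ Cx z v = 0 → fderiv ℝ Cy z v = 0 → v ≠ 0 →
        ∃ w : (Fin n → (Fin 3 → ℝ)) × (Fin n → (Fin 3 → ℝ)),
          fderiv ℝ Cx z w = 0 ∧ fderiv ℝ Cy z w = 0 ∧ stdSymp v w ≠ 0 := by
  obtain rfl : Cx = fun z => totalAngMom z 0 := funext hCx
  obtain rfl : Cy = fun z => totalAngMom z 1 := funext hCy
  have hz2 : totalAngMom z 2 = c := by rw [← hCz, hzz]
  simp only [fderiv_totalAngMom]
  intro v hvx hvy hv
  set u : (Fin n → (Fin 3 → ℝ)) × (Fin n → (Fin 3 → ℝ)) := (-v.2, v.1)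
  -- Correct `u` by infinitesimal rotations, which are `Ω`-orthogonal to `v`.
  let a : Fin 3 → ℝ := ![angMomDeriv z u 1 / c, -(angMomDeriv z u 0 / c), 0]
  refine ⟨u + infinitesimalRotation a z, ?_, ?_, ?_⟩
  · simp [angMomDeriv_add, angMomDeriv_infinitesimalRotation, cross_apply, a, hz2, hc]
  · simp [angMomDeriv_add, angMomDeriv_infinitesimalRotation, cross_apply, a, hz2, hc]
  · have h : a ⬝ᵥ angMomDeriv z v = 0 := by
      simp [dotProduct, Fin.sum_univ_three, a, hvx, hvy]
    rw [stdSymp_add_right, stdSymp_infinitesimalRotation, h, add_zero]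
    exact stdSymp_complexStructure_ne_zero hv
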